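/- (Trustrum's upper bound) For every integer n ≥ 2, one has s(n) < 6 · log₂(n), where log₂ denotes the real base-2 logarithm. -/

import Mathlib

/-- A squared tiling of the `n × n` square: a finite set of triples `(x, y, h)`
representing an `h × h` square with upper-left corner at cell `(x, y)`,
where `1 ≤ h ≤ n - 1`, the square lies inside the board, and every cell
`(i, j)` with `i, j < n` is covered by exactly one square of the tiling. -/
def IsSquaredTiling (n : ℕ) (T : Finset (ℕ × ℕ × ℕ)) : Prop :=
  (∀ t ∈ T, 1 ≤ t.2.2 ∧ t.2.2 ≤ n - 1 ∧ t.1 + t.2.2 ≤ n ∧ t.2.1 + t.2.2 ≤ n) ∧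
  (∀ i j : ℕ, i < n → j < n →
    ∃! t : ℕ × ℕ × ℕ, t ∈ T ∧
      t.1 ≤ i ∧ i < t.1 + t.2.2 ∧ t.2.1 ≤ j ∧ j < t.2.1 + t.2.2)

/-- `s n` is the minimum number of squares in a squared tiling of the
`n × n` square. -/
noncomputable def s (n : ℕ) : ℕ :=
  sInf {k | ∃ T : Finset (ℕ × ℕ × ℕ), IsSquaredTiling n T ∧ T.card = k}

/-- the square `t` covers the cell `(i, j)` -/
def Cov (i j : ℕ) (t : ℕ × ℕ × ℕ) : Bool :=
  decide (t.1 ≤ i ∧ i < t.1 + t.2.2 ∧ t.2.1 ≤ j ∧ j < t.2.1 + t.2.2)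

/-- the list `L` of squares tiles the rectangle at `(x, y)` with sides `w`, `h` -/
def Til (L : List (ℕ × ℕ × ℕ)) (x y w h : ℕ) : Prop :=
  (∀ t ∈ L, 1 ≤ t.2.2) ∧
  ∀ i j, L.countP (Cov i j) = if x ≤ i ∧ i < x + w ∧ y ≤ j ∧ j < y + h then 1 else 0

/-- the `w × h` rectangle is tiled by `k` squares -/
def RT (w h k : ℕ) : Prop := ∃ L, L.length = k ∧ Til L 0 0 w h

theorem RT.shift {w h k : ℕ} (H : RT w h k) (x y : ℕ) : ∃ L, L.length = k ∧ Til L x y w h := by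
  obtain ⟨L, hl, h1, h2⟩ := H
  refine ⟨L.map (fun t => (t.1 + x, t.2.1 + y, t.2.2)), by simp [hl], ?_, ?_⟩
  · intro t ht
    simp only [List.mem_map] at ht
    obtain ⟨a, ha, rfl⟩ := ht
    exact h1 a ha
  · intro i j
    rw [List.countP_map]
    by_cases hc : x ≤ i ∧ y ≤ j
    · have := h2 (i - x) (j - y)
      have e : L.countP (Cov i j ∘ fun t => (t.1 + x, t.2.1 + y, t.2.2)) =
          L.countP (Cov (i - x) (j - y)) := by
        apply List.countP_congr
        intro t _
        simp only [Cov, Function.comp, decide_eq_true_eq]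
        omega
      rw [e, this]
      split_ifs <;> first | rfl | omega
    · rw [if_neg (by omega), List.countP_eq_zero]
      intro t _
      simp only [Cov, Function.comp, decide_eq_true_eq]
      omega

theorem RT.swap {w h k : ℕ} (H : RT w h k) : RT h w k := by
  obtain ⟨L, hl, h1, h2⟩ := H
  refine ⟨L.map (fun t => (t.2.1, t.1, t.2.2)), by simp [hl], ?_, ?_⟩
  · intro t ht
    simp only [List.mem_map] at ht
    obtain ⟨a, ha, rfl⟩ := ht
    exact h1 a ha
  · intro i j
    rw [List.countP_map]
    have e : L.countP (Cov i j ∘ fun t => (t.2.1, t.1, t.2.2)) = L.countP (Cov j i) := by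
      apply List.countP_congr
      intro t _
      simp only [Cov, Function.comp, decide_eq_true_eq]
      omega
    rw [e, h2 j i]
    split_ifs <;> first | rfl | omega

theorem RT.dbl {w h k : ℕ} (H : RT w h k) : RT (2 * w) (2 * h) k := by
  obtain ⟨L, hl, h1, h2⟩ := H
  refine ⟨L.map (fun t => (2 * t.1, 2 * t.2.1, 2 * t.2.2)), by simp [hl], ?_, ?_⟩
  · intro t ht
    simp only [List.mem_map] at ht
    obtain ⟨a, ha, rfl⟩ := ht
    have := h1 a ha
    simp only
    omega
  · intro i j
    rw [List.countP_map]
    have e : L.countP (Cov i j ∘ fun t => (2 * t.1, 2 * t.2.1, 2 * t.2.2)) =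
        L.countP (Cov (i / 2) (j / 2)) := by
      apply List.countP_congr
      intro t _
      simp only [Cov, Function.comp, decide_eq_true_eq]
      omega
    rw [e, h2 (i / 2) (j / 2)]
    split_ifs <;> first | rfl | omega

theorem RT.sq {a : ℕ} (ha : 1 ≤ a) : RT a a 1 := by
  refine ⟨[(0, 0, a)], rfl, by simpa using ha, ?_⟩
  intro i j
  simp [List.countP_cons, Cov]

theorem RT.cat {w w' h k m : ℕ} (H : RT w h k) (H' : RT w' h m) : RT (w + w') h (k + m) := by
  obtain ⟨L, hl, h1, h2⟩ := H.shift 0 0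
  obtain ⟨L', hl', h1', h2'⟩ := H'.shift w 0
  refine ⟨L ++ L', by simp [hl, hl'], ?_, ?_⟩
  · intro t ht
    rcases List.mem_append.1 ht with h | h
    · exact h1 t h
    · exact h1' t h
  · intro i j
    rw [List.countP_append, h2, h2']
    split_ifs <;> first | rfl | omega

theorem RT.sub {w h k : ℕ} (hh : 1 ≤ h) (H : RT w h k) : RT (w + h) h (k + 1) :=
  H.cat (RT.sq hh)

theorem RT.pin {g e f k m : ℕ} (hg : 1 ≤ g) (H : RT (g + 2 * e + 2 * f) g k) (H' : RT e f m) :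
    RT (2 * g + 3 * f + 2 * e) (2 * g + 2 * f + e) (k + m + 3) := by
  obtain ⟨L, hl, h1, h2⟩ := H.shift 0 0
  obtain ⟨L', hl', h1', h2'⟩ := H'.shift (g + 2 * f + e) g
  obtain ⟨P, hlP, hP1, hP2⟩ := (RT.sq (a := g + f) (by omega)).shift (g + 2 * e + 2 * f) 0
  obtain ⟨Q, hlQ, hQ1, hQ2⟩ := (RT.sq (a := g + f + e) (by omega)).shift (g + 2 * f + e) (g + f)
  obtain ⟨R, hlR, hR1, hR2⟩ := (RT.sq (a := g + 2 * f + e) (by omega)).shift 0 g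
  refine ⟨L ++ (L' ++ (P ++ (Q ++ R))), by simp [hl, hl', hlP, hlQ, hlR]; omega, ?_, ?_⟩
  · intro t ht
    simp only [List.mem_append] at ht
    rcases ht with h | h | h | h | h
    · exact h1 t h
    · exact h1' t h
    · exact hP1 t h
    · exact hQ1 t h
    · exact hR1 t h
  · intro i j
    simp only [List.countP_append]
    rw [h2, h2', hP2, hQ2, hR2]
    split_ifs <;> first | rfl | omega

theorem Til.bd {L : List (ℕ × ℕ × ℕ)} {x y w h : ℕ} (H : Til L x y w h) :
    ∀ t ∈ L, 1 ≤ t.2.2 ∧ t.1 + t.2.2 ≤ x + w ∧ t.2.1 + t.2.2 ≤ y + h ∧ x ≤ t.1 ∧ y ≤ t.2.1 := by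
  intro t ht
  have h1 := H.1 t ht
  have a := H.2 (t.1 + t.2.2 - 1) (t.2.1 + t.2.2 - 1)
  have b := H.2 t.1 t.2.1
  have a' : 0 < L.countP (Cov (t.1 + t.2.2 - 1) (t.2.1 + t.2.2 - 1)) := by
    rw [List.countP_pos_iff]
    refine ⟨t, ht, ?_⟩
    simp only [Cov, decide_eq_true_eq]
    omega
  have b' : 0 < L.countP (Cov t.1 t.2.1) := by
    rw [List.countP_pos_iff]
    refine ⟨t, ht, ?_⟩
    simp only [Cov, decide_eq_true_eq]
    omega
  split_ifs at a b <;> omega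

theorem sle_of_list {n : ℕ} {L : List (ℕ × ℕ × ℕ)} (H : Til L 0 0 n n)
    (hb : ∀ t ∈ L, t.2.2 ≤ n - 1) : s n ≤ L.length := by
  refine le_trans (Nat.sInf_le ⟨L.toFinset, ⟨?_, ?_⟩, rfl⟩) (List.toFinset_card_le L)
  · intro t ht
    rw [List.mem_toFinset] at ht
    have := H.bd t ht
    have := hb t ht
    omega
  · intro i j hi hj
    have h := H.2 i j
    rw [if_pos (by omega), List.countP_eq_length_filter, List.length_eq_one_iff] at h
    obtain ⟨t, ht⟩ := h
    have key : ∀ u, (u ∈ L ∧ Cov i j u = true) ↔ u = t := by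
      intro u
      rw [← List.mem_filter, ht, List.mem_singleton]
    refine ⟨t, ?_, ?_⟩
    · have := (key t).2 rfl
      simp only [Cov, decide_eq_true_eq] at this
      simpa using this
    · intro u hu
      apply (key u).1
      simp only [Cov, decide_eq_true_eq]
      simpa using hu

theorem sle_even {m : ℕ} (hm : 1 ≤ m) : s (2 * m) ≤ 4 := by
  have H : RT 2 2 4 := by
    have a : RT 2 1 2 := (RT.sq (le_refl 1)).cat (RT.sq (le_refl 1))
    exact a.swap.cat a.swap
  have hL : Til [(0, 0, m), (m, 0, m), (0, m, m), (m, m, m)] 0 0 (2 * m) (2 * m) := by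
    refine ⟨by simpa using hm, ?_⟩
    intro i j
    simp only [List.countP_cons, List.countP_nil, Cov, decide_eq_true_eq]
    split_ifs <;> first | rfl | omega
  refine sle_of_list hL ?_
  intro t ht
  simp only [List.mem_cons, List.not_mem_nil, or_false] at ht
  rcases ht with rfl | rfl | rfl | rfl <;> simp only <;> omega

theorem sle_odd {m k : ℕ} (hm : 1 ≤ m) (H : RT (m + 1) m k) : s (2 * m + 1) ≤ 2 * k + 2 := by
  obtain ⟨L, hl, hL⟩ := H.shift 0 (m + 1)
  obtain ⟨L', hl', hL'⟩ := H.swap.shift (m + 1) 0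
  have e : (L ++ (L' ++ [(0, 0, m + 1), (m + 1, m + 1, m)])).length = 2 * k + 2 := by
    simp [hl, hl']; omega
  rw [← e]
  apply sle_of_list
  · refine ⟨?_, ?_⟩
    · intro t ht
      simp only [List.mem_append, List.mem_cons, List.not_mem_nil, or_false] at ht
      rcases ht with h | h | rfl | rfl
      · exact hL.1 t h
      · exact hL'.1 t h
      · simp
      · simpa using hm
    · intro i j
      simp only [List.countP_append]
      rw [hL.2, hL'.2]
      simp only [List.countP_cons, List.countP_nil, Cov, decide_eq_true_eq]
      split_ifs <;> first | rfl | omega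
  · intro t ht
    simp only [List.mem_append, List.mem_cons, List.not_mem_nil, or_false] at ht
    rcases ht with h | h | rfl | rfl
    · have := hL.bd t h; omega
    · have := hL'.bd t h; omega
    · simp only; omega
    · simp only; omega

theorem RT.cast {w h k w' h' k' : ℕ} (H : RT w h k) (h1 : w = w') (h2 : h = h') (h3 : k = k') :
    RT w' h' k' := by subst h1 h2 h3; exact H

/-- step on rectangles with consecutive sides -/
theorem stepA {q k : ℕ} (hq : 2 ≤ q) (H : RT (q + 1) (q - 1) k) :
    RT (2 * q + 1) (2 * q) (k + 3) ∧ RT (2 * q) (2 * q - 1) (k + 3) := by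
  have sq : RT (q + q) q 2 := (RT.sq (by omega)).cat (RT.sq (by omega))
  constructor
  · have a : RT (q - 1 + (q + 1)) (q + 1) (k + 1) := H.swap.sub (by omega)
    have b : RT (2 * q) (q + 1) (k + 1) := a.cast (by omega) rfl rfl
    have c : RT (2 * q) q 2 := sq.cast (by omega) rfl rfl
    exact (b.swap.cat c.swap).cast (by omega) (by omega) (by omega)
  · have a : RT (q + 1 + (q - 1)) (q - 1) (k + 1) := H.sub (by omega)
    have b : RT (2 * q) (q - 1) (k + 1) := a.cast (by omega) rfl rfl
    have c : RT (2 * q) q 2 := sq.cast (by omega) rfl rfl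
    exact (b.swap.cat c.swap).swap.cast (by omega) (by omega) (by omega)

theorem r11 : RT 1 1 1 := RT.sq (le_refl 1)
theorem r21 : RT 2 1 2 := r11.sub (by omega)
theorem r31 : RT 3 1 3 := r21.sub (by omega)

theorem stepB {c k : ℕ} (hc : 3 ≤ c) (H : RT (c + 2) (c - 2) k) :
    RT (2 * c + 1) (2 * c - 1) (k + 4) := by
  have := RT.pin (g := c - 2) (e := 1) (f := 1) (by omega) (H.cast (by omega) rfl rfl) r11
  exact this.cast (by omega) (by omega) (by omega)

theorem stepC {t k : ℕ} (ht : 5 ≤ t) (H : RT (t + 4) (t - 4) k) :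
    RT (2 * t + 1) (2 * t - 3) (k + 6) ∧ RT (2 * t + 3) (2 * t - 1) (k + 6) := by
  constructor
  · have := RT.pin (g := t - 4) (e := 3) (f := 1) (by omega) (H.cast (by omega) rfl rfl) r31
    exact this.cast (by omega) (by omega) (by omega)
  · have := RT.pin (g := t - 4) (e := 1) (f := 3) (by omega) (H.cast (by omega) rfl rfl) r31.swap
    exact this.cast (by omega) (by omega) (by omega)

theorem cube_le {a b c : ℕ} (h : c * a ≤ b) : c ^ 3 * a ^ 3 ≤ b ^ 3 := by
  rw [← mul_pow]; exact Nat.pow_le_pow_left h 3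

theorem main_ind (x : ℕ) :
    (∀ v, x = 2 * v + 1 → 1 ≤ v → ∃ R, RT (v + 1) v R ∧ 54 * 2 ^ R ≤ (3 * x - 1) ^ 3) ∧
    (x % 2 = 0 → 2 ≤ x → ∃ R, RT (x + 1) (x - 1) R ∧ 27 * 2 ^ R ≤ 4 * (3 * x - 1) ^ 3) ∧
    (x % 2 = 1 → 3 ≤ x → ∃ R, RT (x + 2) (x - 2) R ∧ 27 * 2 ^ R ≤ 2 * (3 * x - 1) ^ 3) := by
  induction x using Nat.strong_induction_on with
  | _ x ih =>
  -- the rectangle `(u+1) × (u-1)`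
  have hAB : ∀ u, u < x → 2 ≤ u →
      ∃ R, RT (u + 1) (u - 1) R ∧ 27 * 2 ^ R ≤ 4 * (3 * u - 1) ^ 3 := by
    intro u hu h2
    rcases Nat.mod_two_eq_zero_or_one u with h | h
    · exact (ih u hu).2.1 h h2
    · obtain ⟨R, hR, hb⟩ := (ih u hu).1 (u / 2) (by omega) (by omega)
      exact ⟨R, hR.dbl.cast (by omega) (by omega) rfl, by omega⟩
  refine ⟨?_, ?_, ?_⟩
  · intro v hx hv
    obtain ⟨q, hq⟩ : ∃ q, q = (v + 1) / 2 := ⟨_, rfl⟩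
    by_cases hq1 : q = 1
    · obtain rfl | rfl : v = 1 ∨ v = 2 := by omega
      · subst hx
        exact ⟨2, r21, by norm_num⟩
      · subst hx
        exact ⟨3, r21.swap.sub (by omega), by norm_num⟩
    · obtain ⟨R, hR, hb⟩ := hAB q (by omega) (by omega)
      have hs := stepA (by omega) hR
      have hc := cube_le (a := 3 * q - 1) (b := 3 * x - 1) (c := 4) (by omega)
      refine ⟨R + 3, ?_, by rw [pow_add]; omega⟩
      rcases Nat.mod_two_eq_zero_or_one v with h | h
      · exact hs.1.cast (by omega) (by omega) rfl
      · exact hs.2.cast (by omega) (by omega) rfl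
  · intro hx hx2
    obtain ⟨c, rfl⟩ : ∃ c, x = 2 * c := ⟨x / 2, by omega⟩
    rcases Nat.mod_two_eq_zero_or_one c with h | h
    · obtain ⟨u, rfl⟩ : ∃ u, c = 2 * u := ⟨c / 2, by omega⟩
      by_cases hu : u = 1
      · subst hu
        exact ⟨4, ((r21.swap.sub (by omega)).swap.sub (by omega)), by norm_num⟩
      · obtain ⟨R, hR, hb⟩ := hAB u (by omega) (by omega)
        have hs := stepB (c := 2 * u) (by omega) (hR.dbl.cast (by omega) (by omega) rfl)
        have hc := cube_le (a := 3 * u - 1) (b := 3 * (2 * (2 * u)) - 1) (c := 4) (by omega)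
        exact ⟨R + 4, hs, by rw [pow_add]; omega⟩
    · by_cases hc1 : c = 1
      · subst hc1
        exact ⟨3, r31, by norm_num⟩
      · obtain ⟨R, hR, hb⟩ := (ih c (by omega)).2.2 h (by omega)
        have hs := stepB (by omega) hR
        have hc := cube_le (a := 3 * c - 1) (b := 3 * (2 * c) - 1) (c := 2) (by omega)
        exact ⟨R + 4, hs, by rw [pow_add]; omega⟩
  · intro hx hx3
    obtain ⟨t, ht⟩ : ∃ t, t = (x + 1) / 4 := ⟨_, rfl⟩
    have fin : ∀ R, 3 ≤ t → RT (2 * t + 4) (2 * t - 4) R → RT (x + 2) (x - 2) (R + 6) := by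
      intro R h3 hR
      have hs := stepC (t := 2 * t) (by omega) hR
      by_cases h : x = 4 * t - 1
      · exact hs.1.cast (by omega) (by omega) rfl
      · exact hs.2.cast (by omega) (by omega) rfl
    by_cases h1 : t = 1
    · obtain rfl | rfl : x = 3 ∨ x = 5 := by omega
      · exact ⟨5, (r31.sub (by omega)).sub (by omega), by norm_num⟩
      · have a : RT 1 3 3 := r31.swap
        exact ⟨5, (a.sub (by omega)).sub (by omega), by norm_num⟩
    by_cases h2 : t = 2
    · have a : RT 4 1 4 := r31.sub (by omega)
      obtain rfl | rfl : x = 7 ∨ x = 9 := by omega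
      · have b : RT 5 4 5 := a.swap.sub (by omega)
        exact ⟨6, b.swap.sub (by omega), by norm_num⟩
      · have b : RT 4 3 4 := r31.swap.sub (by omega)
        have c : RT 7 4 5 := b.swap.sub (by omega)
        exact ⟨6, c.swap.sub (by omega), by norm_num⟩
    have hc := cube_le (a := 3 * t - 1) (b := 3 * x - 1) (c := 4) (by omega)
    rcases Nat.mod_two_eq_zero_or_one t with h | h
    · obtain ⟨u, rfl⟩ : ∃ u, t = 2 * u := ⟨t / 2, by omega⟩
      obtain ⟨R, hR, hb⟩ := hAB u (by omega) (by omega)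
      have hc' := cube_le (a := 3 * u - 1) (b := 3 * x - 1) (c := 8) (by omega)
      exact ⟨R + 6, fin R (by omega) (hR.dbl.dbl.cast (by omega) (by omega) rfl),
        by rw [pow_add]; omega⟩
    · obtain ⟨R, hR, hb⟩ := (ih t (by omega)).2.2 h (by omega)
      exact ⟨R + 6, fin R (by omega) (hR.dbl.cast (by omega) (by omega) rfl),
        by rw [pow_add]; omega⟩

theorem two_pow_s_lt (n : ℕ) (hn : 2 ≤ n) : 2 ^ s n < n ^ 6 := by
  rcases Nat.even_or_odd' n with ⟨m, rfl | rfl⟩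
  · calc 2 ^ s (2 * m) ≤ 2 ^ 4 := Nat.pow_le_pow_right (by omega) (sle_even (by omega))
      _ < 2 ^ 6 := by norm_num
      _ ≤ (2 * m) ^ 6 := Nat.pow_le_pow_left hn 6
  · obtain ⟨R, hR, hb⟩ := (main_ind (2 * m + 1)).1 m rfl (by omega)
    have h1 : (3 * (2 * m + 1) - 1) ^ 3 < (3 * (2 * m + 1)) ^ 3 :=
      Nat.pow_lt_pow_left (by omega) (by omega)
    rw [mul_pow] at h1
    have h2 : 2 ^ (R + 1) < (2 * m + 1) ^ 3 := by rw [pow_succ]; omega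
    calc 2 ^ s (2 * m + 1) ≤ 2 ^ (2 * R + 2) :=
          Nat.pow_le_pow_right (by omega) (sle_odd (by omega) hR)
      _ = (2 ^ (R + 1)) ^ 2 := by rw [← pow_mul]; congr 1; ring
      _ < ((2 * m + 1) ^ 3) ^ 2 := Nat.pow_lt_pow_left h2 (by omega)
      _ = (2 * m + 1) ^ 6 := by rw [← pow_mul]

theorem trustrum_upper_bound (n : ℕ) (hn : 2 ≤ n) :
    (s n : ℝ) < 6 * Real.logb 2 (n : ℝ) := by
  have h : ((2 : ℝ)) ^ s n < (n : ℝ) ^ 6 := by exact_mod_cast two_pow_s_lt n hn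
  have h' := Real.logb_lt_logb (b := 2) (by norm_num) (by positivity) h
  rw [Real.logb_pow, Real.logb_pow, Real.logb_self_eq_one (by norm_num)] at h'
  simpa using h'
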